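/- arXiv:2109.11882 — 9 statements merged into one kernel-verified Lean document; each statement's English description precedes it below -/
import Mathlib

section
/- Let G ⊆ ℝ^d be a polyhedral convex set (an intersection of finitely many closed half-spaces) with nonempty interior, and let f be a nonnegative concave real-valued function defined on the interior of G. Then for every boundary point x of G, the limit of f(y) as y tends to x with y ranging over the interior of G exists (and is finite). -/
open scoped BigOperators

noncomputable section

/-- `G` is a polyhedral convex set: an intersection of finitely many closed half-spaces. -/
def IsPolyhedral {d : ℕ} (G : Set (Fin d → ℝ)) : Prop :=
  ∃ (n : ℕ) (a : Fin n → Fin d → ℝ) (b : Fin n → ℝ),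
    G = {x | ∀ j, ∑ i, a j i * x i ≤ b j}

open Filter Topology in
/-- A nonnegative real function that asymptotically dominates every contraction of its own values
along a filter converges along that filter. -/
theorem exists_tendsto_of_eventually_mul_le {α : Type*} {l : Filter α} {f : α → ℝ}
    (hnn : ∀ᶠ y in l, 0 ≤ f y)
    (h : ∀ s : ℝ, 0 < s → s < 1 → ∀ᶠ y in l, ∀ᶠ y' in l, (1 - s) * f y' ≤ f y) :
    ∃ L : ℝ, Tendsto f l (𝓝 L) := by
  rcases l.eq_or_neBot with rfl | _
  · exact ⟨0, tendsto_bot⟩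
  have hbelow : IsBoundedUnder (· ≥ ·) l f := ⟨0, by simpa using hnn⟩
  have habove : IsBoundedUnder (· ≤ ·) l f := by
    obtain ⟨y, hy⟩ := (h (1 / 2) (by norm_num) (by norm_num)).exists
    refine ⟨2 * f y, ?_⟩
    rw [eventually_map]
    filter_upwards [hy] with y' hy'
    linarith
  set L := limsup f l
  have hkey : ∀ s : ℝ, 0 < s → s < 1 → ∀ᶠ y in l, (1 - s) * L ≤ f y := by
    intro s hs hs1
    filter_upwards [h s hs hs1] with y hy
    have : L ≤ f y / (1 - s) := by
      refine limsup_le_of_le hbelow.isCoboundedUnder_le ?_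
      filter_upwards [hy] with y' hy'
      rw [le_div_iff₀ (by linarith)]
      linarith
    rw [le_div_iff₀ (by linarith)] at this
    linarith
  refine ⟨L, tendsto_order.2 ⟨fun a ha => ?_, fun a ha => eventually_lt_of_limsup_lt ha habove⟩⟩
  have hcont : Tendsto (fun s : ℝ => (1 - s) * L) (𝓝[>] 0) (𝓝 L) := by
    have : Continuous fun s : ℝ => (1 - s) * L := by fun_prop
    simpa using (this.tendsto 0).mono_left nhdsWithin_le_nhds
  obtain ⟨s, has, hs, hs1⟩ :=
    ((hcont.eventually (lt_mem_nhds ha)).and (Ioo_mem_nhdsGT (zero_lt_one' ℝ))).exists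
  filter_upwards [hkey s hs hs1] with y hy using has.trans_le hy

theorem IsPolyhedral.isClosed {d : ℕ} {G : Set (Fin d → ℝ)} (hG : IsPolyhedral G) :
    IsClosed G := by
  obtain ⟨n, a, b, rfl⟩ := hG
  simp only [Set.ofPred_forall]
  exact isClosed_iInter fun j => isClosed_le (by fun_prop) continuous_const

open Filter Topology in
/-- A polyhedral set is locally a cone at each of its points. -/
theorem IsPolyhedral.eventually_mem_of_homothety_mem {d : ℕ} {G : Set (Fin d → ℝ)}
    (hG : IsPolyhedral G) {x : Fin d → ℝ} (hx : x ∈ G) :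
    ∀ᶠ z in 𝓝 x, ∀ s : ℝ, 0 < s → AffineMap.homothety x s z ∈ G → z ∈ G := by
  obtain ⟨n, a, b, rfl⟩ := hG
  have hev : ∀ᶠ z in 𝓝 x, ∀ j, ∑ i, a j i * x i < b j → ∑ i, a j i * z i < b j := by
    refine eventually_all.2 fun j => ?_
    by_cases hj : ∑ i, a j i * x i < b j
    · have hc : Continuous fun z : Fin d → ℝ => ∑ i, a j i * z i := by fun_prop
      filter_upwards [hc.continuousAt.eventually (gt_mem_nhds hj)] with z hz _ using hz
    · exact Eventually.of_forall fun z h => absurd h hj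
  filter_upwards [hev] with z hz s hs hmem j
  rcases (hx j).lt_or_eq with hj | hj
  · exact (hz j hj).le
  have hlin : ∑ i, a j i * AffineMap.homothety x s z i
      = s * (∑ i, a j i * z i - ∑ i, a j i * x i) + ∑ i, a j i * x i := by
    rw [← Finset.sum_sub_distrib, Finset.mul_sum, ← Finset.sum_add_distrib]
    refine Finset.sum_congr rfl fun i _ => ?_
    simp only [AffineMap.homothety_apply, vsub_eq_sub, vadd_eq_add, Pi.add_apply, Pi.smul_apply,
      Pi.sub_apply, smul_eq_mul]
    ring
  have hle := hmem j
  rw [hlin, hj] at hle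
  have : s * (∑ i, a j i * z i - b j) ≤ 0 := by linarith
  linarith [nonpos_of_mul_nonpos_right this hs]

open Filter Topology in
/-- Dilations centred at a point `x` of a polyhedral set keep interior points near `x` in the
interior. -/
theorem IsPolyhedral.eventually_homothety_inv_mem_interior {d : ℕ} {G : Set (Fin d → ℝ)}
    (hG : IsPolyhedral G) {x : Fin d → ℝ} (hx : x ∈ G) {s : ℝ} (hs : 0 < s) :
    ∀ᶠ y in 𝓝[interior G] x, AffineMap.homothety x s⁻¹ y ∈ interior G := by
  have hc : ∀ t : ℝ, Continuous (AffineMap.homothety x t : (Fin d → ℝ) → (Fin d → ℝ)) :=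
    fun t => AffineMap.homothety_continuous x t
  have htend : Tendsto (AffineMap.homothety x s⁻¹) (𝓝 x) (𝓝 x) := by
    simpa using (hc s⁻¹).tendsto x
  have hcone := (hG.eventually_mem_of_homothety_mem hx).eventually_nhds
  filter_upwards [self_mem_nhdsWithin, nhdsWithin_le_nhds (htend.eventually hcone)] with y hy hW
  rw [mem_interior_iff_mem_nhds]
  have hback : AffineMap.homothety x s (AffineMap.homothety x s⁻¹ y) = y := by
    rw [← AffineMap.homothety_mul_apply, mul_inv_cancel₀ hs.ne', AffineMap.homothety_one,
      AffineMap.id_apply]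
  have hmem : ∀ᶠ z in 𝓝 (AffineMap.homothety x s⁻¹ y),
      AffineMap.homothety x s z ∈ interior G := by
    refine (hc s).continuousAt.eventually ?_
    rw [hback]
    exact isOpen_interior.mem_nhds hy
  filter_upwards [hW, hmem] with z hz hz' using hz s hs (interior_subset hz')

/-- For a polyhedral convex set `G` with nonempty interior and a nonnegative concave
function `f` on the interior of `G`, at every boundary point `x` of `G` the limit of
`f(y)` as `y → x` along the interior of `G` exists (and is finite). -/
theorem concave_limit_at_boundary_of_polyhedral (d : ℕ) (G : Set (Fin d → ℝ))
    (hpoly : IsPolyhedral G)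
    (hint : (interior G).Nonempty)
    (f : (Fin d → ℝ) → ℝ)
    (hnn : ∀ x ∈ interior G, 0 ≤ f x)
    (hconc : ConcaveOn ℝ (interior G) f) :
    ∀ x ∈ frontier G, ∃ L : ℝ,
      Filter.Tendsto f (nhdsWithin x (interior G)) (nhds L) := by
  intro x hx
  have hxG : x ∈ G := hpoly.isClosed.frontier_subset hx
  refine exists_tendsto_of_eventually_mul_le ?_ fun s hs hs1 => ?_
  · filter_upwards [self_mem_nhdsWithin] with y hy using hnn y hy
  filter_upwards [hpoly.eventually_homothety_inv_mem_interior hxG hs] with y hy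
  have hcont : Continuous fun y' : Fin d → ℝ => s⁻¹ • (y - (1 - s) • y') := by fun_prop
  have hval : s⁻¹ • (y - (1 - s) • x) = AffineMap.homothety x s⁻¹ y := by
    ext i
    simp only [AffineMap.homothety_apply, vsub_eq_sub, vadd_eq_add, Pi.add_apply, Pi.smul_apply,
      Pi.sub_apply, smul_eq_mul]
    field_simp
    ring
  have hev : ∀ᶠ y' in nhds x, s⁻¹ • (y - (1 - s) • y') ∈ interior G :=
    hcont.continuousAt.eventually (isOpen_interior.mem_nhds (by simpa only [hval] using hy))
  filter_upwards [self_mem_nhdsWithin, nhdsWithin_le_nhds hev] with y' hy' hv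
  have hle := hconc.2 hy' hv (sub_nonneg.2 hs1.le) hs.le (by ring)
  rw [smul_inv_smul₀ hs.ne', add_sub_cancel, smul_eq_mul, smul_eq_mul] at hle
  linarith [mul_nonneg hs.le (hnn _ hv)]
end
end

section
/- Let G ⊆ ℝ^d be a polyhedral convex set with nonempty interior and let f : G → ℝ be a nonnegative concave function. Then f possesses a unique continuous extension F : G → ℝ, i.e., a continuous concave function F on G with F(x) = f(x) for all x in the interior of G; this unique F satisfies F(x) ≥ f(x) for every x ∈ G. -/
open scoped BigOperators

noncomputable section

open Set Filter Topology

section RadialExtension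

variable {E : Type*} [NormedAddCommGroup E] [NormedSpace ℝ E]

/-- The value at `x` of the affine function that agrees with `f` at `x₀` and at the point
`(1 - t) • x + t • x₀` of the segment from `x` to `x₀`. -/
def radialMajorant (f : E → ℝ) (x₀ : E) (t : ℝ) (x : E) : ℝ :=
  (f ((1 - t) • x + t • x₀) - t * f x₀) / (1 - t)

/-- The infimum of the radial majorants of `f` over `0 < t < 1`. -/
def radialExtension (f : E → ℝ) (x₀ x : E) : ℝ :=
  ⨅ t : Ioo (0 : ℝ) 1, radialMajorant f x₀ t x

variable {G : Set E} {f F : E → ℝ} {x₀ x : E} {t : ℝ}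

lemma nonempty_Ioo_zero_one : Nonempty (Ioo (0 : ℝ) 1) := ⟨⟨1 / 2, by norm_num, by norm_num⟩⟩

lemma ConcaveOn.le_radialMajorant (hf : ConcaveOn ℝ G f) (hx₀ : x₀ ∈ G) (hx : x ∈ G)
    (ht : t ∈ Ioo (0 : ℝ) 1) : f x ≤ radialMajorant f x₀ t x := by
  have h := hf.2 hx hx₀ (sub_nonneg.2 ht.2.le) ht.1.le (sub_add_cancel 1 t)
  simp only [smul_eq_mul] at h
  rw [radialMajorant, le_div_iff₀ (sub_pos.2 ht.2)]
  linarith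

lemma ConcaveOn.radialExtension_le (hf : ConcaveOn ℝ G f) (hx₀ : x₀ ∈ G) (hx : x ∈ G)
    (ht : t ∈ Ioo (0 : ℝ) 1) : radialExtension f x₀ x ≤ radialMajorant f x₀ t x :=
  ciInf_le ⟨f x, forall_mem_range.2 fun s ↦ hf.le_radialMajorant hx₀ hx s.2⟩
    (⟨t, ht⟩ : Ioo (0 : ℝ) 1)

lemma ConcaveOn.le_radialExtension (hf : ConcaveOn ℝ G f) (hx₀ : x₀ ∈ G) (hx : x ∈ G) :
    f x ≤ radialExtension f x₀ x :=
  have := nonempty_Ioo_zero_one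
  le_ciInf fun s ↦ hf.le_radialMajorant hx₀ hx s.2

lemma ConcaveOn.concaveOn_radialMajorant (hf : ConcaveOn ℝ G f) (hx₀ : x₀ ∈ G)
    (ht : t ∈ Ioo (0 : ℝ) 1) : ConcaveOn ℝ G (radialMajorant f x₀ t) := by
  have hmem : ∀ z ∈ G, (1 - t) • z + t • x₀ ∈ G := fun z hz ↦
    hf.1 hz hx₀ (sub_nonneg.2 ht.2.le) ht.1.le (sub_add_cancel 1 t)
  refine ⟨hf.1, fun y hy z hz a b ha hb hab ↦ ?_⟩
  have h := hf.2 (hmem y hy) (hmem z hz) ha hb hab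
  have heq : a • ((1 - t) • y + t • x₀) + b • ((1 - t) • z + t • x₀)
      = (1 - t) • (a • y + b • z) + t • x₀ := by
    obtain rfl : b = 1 - a := by linarith
    module
  rw [heq] at h
  simp only [smul_eq_mul, radialMajorant] at h ⊢
  rw [← mul_div_assoc, ← mul_div_assoc, ← add_div]
  refine div_le_div_of_nonneg_right ?_ (sub_nonneg.2 ht.2.le)
  obtain rfl : b = 1 - a := by linarith
  linarith

lemma ConcaveOn.concaveOn_radialExtension (hf : ConcaveOn ℝ G f) (hx₀ : x₀ ∈ G) :
    ConcaveOn ℝ G (radialExtension f x₀) := by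
  have := nonempty_Ioo_zero_one
  refine ⟨hf.1, fun y hy z hz a b ha hb hab ↦ le_ciInf fun s ↦ ?_⟩
  refine le_trans ?_ ((hf.concaveOn_radialMajorant hx₀ s.2).2 hy hz ha hb hab)
  exact add_le_add (smul_le_smul_of_nonneg_left (hf.radialExtension_le hx₀ hy s.2) ha)
    (smul_le_smul_of_nonneg_left (hf.radialExtension_le hx₀ hz s.2) hb)

lemma Convex.radial_mem_interior (hG : Convex ℝ G) (hx₀ : x₀ ∈ interior G) (hx : x ∈ G)
    (ht : t ∈ Ioo (0 : ℝ) 1) : (1 - t) • x + t • x₀ ∈ interior G :=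
  hG.combo_self_interior_mem_interior hx hx₀ (sub_nonneg.2 ht.2.le) ht.1 (sub_add_cancel 1 t)

/-- A concave function that agrees with `f` on the interior of `G` equals the radial extension
of `f` wherever it is continuous relative to `G`. -/
lemma ConcaveOn.eq_radialExtension (hf : ConcaveOn ℝ G f) (hF : ConcaveOn ℝ G F)
    (hx₀ : x₀ ∈ interior G) (hfF : ∀ y ∈ interior G, F y = f y) (hx : x ∈ G)
    (hcont : ContinuousWithinAt F G x) : F x = radialExtension f x₀ x := by
  have := nonempty_Ioo_zero_one
  have hx₀G := interior_subset hx₀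
  have hmaj : ∀ s ∈ Ioo (0 : ℝ) 1, radialMajorant F x₀ s x
      = radialMajorant f x₀ s x := fun s hs ↦ by
    rw [radialMajorant, radialMajorant, hfF _ hx₀,
      hfF _ (hf.1.radial_mem_interior hx₀ hx hs)]
  refine le_antisymm (le_ciInf fun s ↦ ?_) ?_
  · rw [← hmaj s s.2]
    exact hF.le_radialMajorant hx₀G hx s.2
  · have hIoo : ∀ᶠ s in 𝓝[>] (0 : ℝ), s ∈ Ioo (0 : ℝ) 1 := Ioo_mem_nhdsGT one_pos
    have hpath : Tendsto (fun s : ℝ ↦ (1 - s) • x + s • x₀) (𝓝[>] 0) (𝓝[G] x) := by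
      refine tendsto_nhdsWithin_iff.2 ⟨?_, ?_⟩
      · have hc : Continuous fun s : ℝ ↦ (1 - s) • x + s • x₀ := by fun_prop
        simpa using (hc.tendsto 0).mono_left nhdsWithin_le_nhds
      · filter_upwards [hIoo] with s hs
        exact interior_subset (hf.1.radial_mem_interior hx₀ hx hs)
    have hid : Tendsto (fun s : ℝ ↦ s) (𝓝[>] 0) (𝓝 0) := nhdsWithin_le_nhds
    have hlim : Tendsto (fun s ↦ radialMajorant F x₀ s x) (𝓝[>] 0) (𝓝 (F x)) := by
      have h := ((hcont.tendsto.comp hpath).sub (hid.mul_const (F x₀))).div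
        (tendsto_const_nhds.sub hid) (by norm_num : (1 : ℝ) - 0 ≠ 0)
      rw [sub_zero, zero_mul, sub_zero, div_one] at h
      exact h
    refine ge_of_tendsto hlim ?_
    filter_upwards [hIoo] with s hs
    rw [hmaj s hs]
    exact hf.radialExtension_le hx₀G hx hs

lemma ConcaveOn.eventually_radialExtension_lt [FiniteDimensional ℝ E] (hf : ConcaveOn ℝ G f)
    (hx₀ : x₀ ∈ interior G) (hx : x ∈ G) {c : ℝ} (hc : radialExtension f x₀ x < c) :
    ∀ᶠ y in 𝓝[G] x, radialExtension f x₀ y < c := by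
  have := nonempty_Ioo_zero_one
  obtain ⟨⟨s, hs⟩, hsc⟩ := exists_lt_of_ciInf_lt hc
  have hcont : ContinuousOn (radialMajorant f x₀ s) G := by
    refine ContinuousOn.div_const (ContinuousOn.sub ?_ continuousOn_const) _
    exact hf.continuousOn_interior.comp (by fun_prop)
      fun y hy ↦ hf.1.radial_mem_interior hx₀ hy hs
  filter_upwards [(hcont x hx).eventually_lt_const hsc, self_mem_nhdsWithin] with y hy hyG
  exact (hf.radialExtension_le (interior_subset hx₀) hyG hs).trans_lt hy

end RadialExtension

lemma IsPolyhedral.eventually_dilation_mem {d : ℕ} {G : Set (Fin d → ℝ)} (hG : IsPolyhedral G)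
    {x : Fin d → ℝ} (hx : x ∈ G) {r : ℝ} (hr : 0 ≤ r) :
    ∀ᶠ y in 𝓝[G] x, x + r • (y - x) ∈ G := by
  obtain ⟨n, a, b, rfl⟩ := hG
  simp only [mem_ofPred_eq] at hx ⊢
  refine eventually_all.2 fun j ↦ ?_
  rcases (hx j).lt_or_eq with hlt | heq
  · have hc : Continuous fun y : Fin d → ℝ ↦ ∑ i, a j i * (x + r • (y - x)) i := by fun_prop
    have h := (hc.tendsto x).mono_left (nhdsWithin_le_nhds (s := {x | ∀ j, ∑ i, a j i * x i ≤ b j}))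
    exact (h.eventually_lt_const (by simpa using hlt)).mono fun _ ↦ le_of_lt
  · filter_upwards [self_mem_nhdsWithin] with y hy
    have hsum : ∑ i, a j i * (x + r • (y - x)) i
        = ∑ i, a j i * x i + r * (∑ i, a j i * y i - ∑ i, a j i * x i) := by
      rw [← Finset.sum_sub_distrib, Finset.mul_sum, ← Finset.sum_add_distrib]
      refine Finset.sum_congr rfl fun i _ ↦ ?_
      simp only [Pi.add_apply, Pi.smul_apply, Pi.sub_apply, smul_eq_mul]
      ring
    rw [hsum, heq]
    have := mul_nonneg hr (sub_nonneg.2 (hy j))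
    linarith

/-- A nonnegative concave function on a polyhedral set is lower semicontinuous. -/
lemma IsPolyhedral.eventually_lt_of_concaveOn {d : ℕ} {G : Set (Fin d → ℝ)}
    (hG : IsPolyhedral G) {F : (Fin d → ℝ) → ℝ} (hF : ConcaveOn ℝ G F)
    (hnn : ∀ x ∈ G, 0 ≤ F x) {x : Fin d → ℝ} (hx : x ∈ G) {c : ℝ} (hc : c < F x) :
    ∀ᶠ y in 𝓝[G] x, c < F y := by
  obtain ⟨s, hsc, hs⟩ : ∃ s : ℝ, c < (1 - s) * F x ∧ s ∈ Ioo (0 : ℝ) 1 := by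
    have hlim : Tendsto (fun s : ℝ ↦ (1 - s) * F x) (𝓝[>] 0) (𝓝 (F x)) := by
      have h : Continuous fun s : ℝ ↦ (1 - s) * F x := by fun_prop
      simpa using (h.tendsto 0).mono_left nhdsWithin_le_nhds
    exact ((hlim.eventually_const_lt hc).and (Ioo_mem_nhdsGT one_pos)).exists
  filter_upwards [hG.eventually_dilation_mem hx (inv_nonneg.2 hs.1.le)] with y hz
  have h := hF.2 hx hz (sub_nonneg.2 hs.2.le) hs.1.le (sub_add_cancel 1 s)
  have heq : (1 - s) • x + s • (x + s⁻¹ • (y - x)) = y := by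
    rw [smul_add, smul_inv_smul₀ hs.1.ne']
    module
  rw [heq, smul_eq_mul, smul_eq_mul] at h
  have := mul_nonneg hs.1.le (hnn _ hz)
  linarith

/-- Every nonnegative concave function on a polyhedral set `G` with nonempty interior
possesses a unique continuous extension `F` (continuous concave on `G`, agreeing with
`f` on the interior of `G`), and `F ≥ f` on `G`. -/
theorem concave_continuous_extension_of_polyhedral (d : ℕ) (G : Set (Fin d → ℝ))
    (hpoly : IsPolyhedral G)
    (hint : (interior G).Nonempty)
    (f : (Fin d → ℝ) → ℝ)
    (hnn : ∀ x ∈ G, 0 ≤ f x)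
    (hconc : ConcaveOn ℝ G f) :
    ∃ F : (Fin d → ℝ) → ℝ,
      (ContinuousOn F G ∧ ConcaveOn ℝ G F ∧ ∀ x ∈ interior G, F x = f x) ∧
      (∀ F' : (Fin d → ℝ) → ℝ,
        (ContinuousOn F' G ∧ ConcaveOn ℝ G F' ∧ ∀ x ∈ interior G, F' x = f x) →
        ∀ x ∈ G, F' x = F x) ∧
      (∀ x ∈ G, f x ≤ F x) := by
  obtain ⟨x₀, hx₀⟩ := hint
  have hx₀G := interior_subset hx₀
  have hF := hconc.concaveOn_radialExtension hx₀G
  have hle : ∀ x ∈ G, f x ≤ radialExtension f x₀ x := fun x hx ↦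
    hconc.le_radialExtension hx₀G hx
  refine ⟨radialExtension f x₀, ⟨fun x hx ↦ tendsto_order.2 ⟨fun c hc ↦ ?_, fun c hc ↦ ?_⟩, hF,
    fun x hx ↦ ?_⟩, fun F' hF' x hx ↦ ?_, hle⟩
  · exact hpoly.eventually_lt_of_concaveOn hF (fun y hy ↦ (hnn y hy).trans (hle y hy)) hx hc
  · exact hconc.eventually_radialExtension_lt hx₀ hx hc
  · exact (hconc.eq_radialExtension hconc hx₀ (fun _ _ ↦ rfl) (interior_subset hx)
      (hconc.continuousOn_interior.continuousAt
        (isOpen_interior.mem_nhds hx)).continuousWithinAt).symm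
  · exact hconc.eq_radialExtension hF'.2.1 hx₀ hF'.2.2 hx (hF'.1 x hx)
end
end

section
/- For an arbitrary antinorm f on the positive orthant ℝ^d₊, the double dual equals the continuous extension: f**(x) = F(x) for all x ∈ ℝ^d₊, where F is the continuous extension of f. -/
open scoped BigOperators

noncomputable section

/-- The positive orthant in `ℝ^d`. -/
def pos (d : ℕ) : Set (Fin d → ℝ) := {x | ∀ i, 0 ≤ x i}

/-- Euclidean inner product of two vectors. -/
def dot {d : ℕ} (p x : Fin d → ℝ) : ℝ := ∑ i, p i * x i

/-- An antinorm on the positive orthant: nonnegative, positively homogeneous,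
concave and strictly positive somewhere. -/
def IsAntinorm {d : ℕ} (f : (Fin d → ℝ) → ℝ) : Prop :=
  (∀ x ∈ pos d, 0 ≤ f x) ∧
  (∀ x ∈ pos d, ∀ l : ℝ, 0 ≤ l → f (l • x) = l * f x) ∧
  ConcaveOn ℝ (pos d) f ∧
  ∃ x ∈ pos d, 0 < f x

/-- The dual antinorm `f*(p) = inf {⟨p,x⟩/f(x) : x ∈ ℝ^d₊, f(x) ≠ 0}`. -/
def dualAntinorm {d : ℕ} (f : (Fin d → ℝ) → ℝ) (p : Fin d → ℝ) : ℝ :=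
  sInf ((fun x => dot p x / f x) '' {x | x ∈ pos d ∧ f x ≠ 0})

lemma interior_pos (d : ℕ) : interior (pos d) = {x | ∀ i, 0 < x i} := by
  have h : pos d = Set.univ.pi fun _ => Set.Ici (0 : ℝ) := by
    ext x
    simp [pos, Pi.le_def]
  rw [h, interior_pi_set Set.finite_univ]
  ext x
  simp

lemma dot_add {d : ℕ} (p x y : Fin d → ℝ) : dot p (x + y) = dot p x + dot p y := by
  simp [dot, mul_add, Finset.sum_add_distrib]

lemma dot_nonneg {d : ℕ} {p x : Fin d → ℝ} (hp : p ∈ pos d) (hx : x ∈ pos d) : 0 ≤ dot p x :=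
  Finset.sum_nonneg fun i _ => mul_nonneg (hp i) (hx i)

lemma dot_comm {d : ℕ} (p x : Fin d → ℝ) : dot p x = dot x p := by
  simp [dot, mul_comm]

lemma add_mem_interior_pos {d : ℕ} {x y : Fin d → ℝ} (hx : x ∈ pos d)
    (hy : y ∈ interior (pos d)) : x + y ∈ interior (pos d) := by
  rw [interior_pos] at *
  exact fun i => add_pos_of_nonneg_of_pos (hx i) (hy i)

lemma smul_mem_interior_pos {d : ℕ} {x : Fin d → ℝ} (hx : x ∈ interior (pos d)) {c : ℝ}
    (hc : 0 < c) : c • x ∈ interior (pos d) := by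
  rw [interior_pos] at *
  exact fun i => mul_pos hc (hx i)

lemma IsAntinorm.superadditive {d : ℕ} {f : (Fin d → ℝ) → ℝ} (hf : IsAntinorm f)
    {x y : Fin d → ℝ} (hx : x ∈ pos d) (hy : y ∈ pos d) : f x + f y ≤ f (x + y) := by
  obtain ⟨-, hhom, hconc, -⟩ := hf
  have hxy : x + y ∈ pos d := fun i => add_nonneg (hx i) (hy i)
  have h := hconc.2 hx hy one_half_pos.le one_half_pos.le (add_halves (1 : ℝ))
  rw [← smul_add, ← smul_add, hhom _ hxy _ one_half_pos.le, smul_eq_mul] at h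
  linarith

lemma IsAntinorm.pos_of_mem_interior {d : ℕ} {f : (Fin d → ℝ) → ℝ} (hf : IsAntinorm f)
    {x : Fin d → ℝ} (hx : x ∈ interior (pos d)) : 0 < f x := by
  obtain ⟨y, hy, hfy⟩ := hf.2.2.2
  have hcont : Filter.Tendsto (fun c : ℝ => x - c • y) (nhdsWithin 0 (Set.Ioi 0)) (nhds x) := by
    have : Continuous fun c : ℝ => x - c • y := by fun_prop
    simpa using (this.tendsto 0).mono_left nhdsWithin_le_nhds
  obtain ⟨c, hc, hcpos⟩ := ((hcont.eventually (isOpen_interior.mem_nhds hx)).and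
    self_mem_nhdsWithin).exists
  have hc0 : (0 : ℝ) < c := hcpos
  have hz : x - c • y ∈ pos d := interior_subset hc
  have h := hf.superadditive hz (y := c • y) fun i => mul_nonneg hc0.le (hy i)
  rw [sub_add_cancel, hf.2.1 y hy c hc0.le] at h
  linarith [hf.1 _ hz, mul_pos hc0 hfy]

/-- A positively homogeneous concave function on the orthant has a supporting linear functional,
with nonnegative coefficients, at each interior point. -/
lemma IsAntinorm.exists_supporting {d : ℕ} {f : (Fin d → ℝ) → ℝ} (hf : IsAntinorm f)
    {x : Fin d → ℝ} (hx : x ∈ interior (pos d)) :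
    ∃ p ∈ pos d, (∀ y ∈ pos d, f y ≤ dot p y) ∧ dot p x = f x := by
  have hconc : ConcaveOn ℝ (interior (pos d)) f :=
    hf.2.2.1.subset interior_subset hf.2.2.1.1.interior
  have hcont : ContinuousOn f (interior (pos d)) := hconc.continuousOn isOpen_interior
  have hopen : IsOpen {q : (Fin d → ℝ) × ℝ | q.1 ∈ interior (pos d) ∧ q.2 < f q.1} := by
    rw [isOpen_iff_mem_nhds]
    rintro ⟨y, t⟩ ⟨hy, ht⟩
    have hfy : ContinuousAt (fun q : (Fin d → ℝ) × ℝ => f q.1) (y, t) :=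
      ContinuousAt.comp (hcont.continuousAt (isOpen_interior.mem_nhds hy)) continuousAt_fst
    filter_upwards [continuousAt_snd.eventually_lt hfy ht,
      continuousAt_fst.eventually (isOpen_interior.mem_nhds hy)] with q h1 h2
    exact ⟨h2, h1⟩
  obtain ⟨g, hg⟩ := geometric_hahn_banach_open_point hconc.convex_strict_hypograph hopen
    (x := (x, f x)) (fun h => lt_irrefl _ h.2)
  have hsplit : ∀ y t, g (y, t) = g (y, 0) + t * g (0, 1) := by
    intro y t
    rw [← smul_eq_mul, ← map_smul, ← map_add]
    simp
  set c := g (0, 1)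
  have hc : 0 < c := by
    have h := hg (x, f x - 1) ⟨hx, by simp⟩
    rw [hsplit, hsplit x (f x)] at h
    linarith
  have hle : ∀ y ∈ interior (pos d), g (y, 0) + f y * c ≤ g (x, 0) + f x * c := by
    intro y hy
    refine le_of_forall_pos_lt_add fun ε hε => ?_
    have h := hg (y, f y - ε / c) ⟨hy, by simp; positivity⟩
    rw [hsplit, hsplit x (f x), sub_mul, div_mul_cancel₀ _ hc.ne'] at h
    linarith
  have hscale : ∀ l : ℝ, 0 < l → (l - 1) * (g (x, 0) + f x * c) ≤ 0 := by
    intro l hl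
    have h := hle _ (smul_mem_interior_pos hx hl)
    have hgx : g (l • x, 0) = l * g (x, 0) := by
      rw [← smul_eq_mul, ← map_smul]
      simp
    rw [hf.2.1 x (interior_subset hx) l hl.le, hgx] at h
    linarith
  have hzero : g (x, 0) + f x * c = 0 := by
    have h1 := hscale 2 (by norm_num)
    have h2 := hscale (1 / 2) (by norm_num)
    linarith
  let p : Fin d → ℝ := fun i => -g (Pi.single i 1, 0) / c
  have hp : ∀ y, dot p y = -g (y, 0) / c := by
    intro y
    have h := ((g : (Fin d → ℝ) × ℝ →ₗ[ℝ] ℝ) ∘ₗ LinearMap.inl ℝ (Fin d → ℝ) ℝ).pi_apply_eq_sum_univ y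
    have hsingle : ∀ i : Fin d, (fun j => if i = j then (1 : ℝ) else 0) = Pi.single i 1 := by
      intro i
      ext j
      simp [Pi.single_apply, eq_comm]
    have h' : g (y, 0) = ∑ i, y i * g (Pi.single i 1, 0) := by
      simpa [hsingle] using h
    rw [h', ← Finset.sum_neg_distrib, Finset.sum_div]
    exact Finset.sum_congr rfl fun i _ => by simp only [p]; ring
  have hpx : dot p x = f x := by
    rw [hp, div_eq_iff hc.ne']
    linarith
  have hpint : ∀ y ∈ interior (pos d), f y ≤ dot p y := by
    intro y hy
    rw [hp, le_div_iff₀ hc]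
    linarith [hle y hy]
  have hppos : ∀ y ∈ pos d, f y ≤ dot p y := by
    intro y hy
    have h := hpint _ (add_mem_interior_pos hy hx)
    rw [dot_add, hpx] at h
    linarith [hf.superadditive hy (interior_subset hx)]
  refine ⟨p, fun i => ?_, hppos, hpx⟩
  have hi : (Pi.single i 1 : Fin d → ℝ) ∈ pos d := fun j => by
    by_cases h : j = i
    · subst h; simp
    · simp [h]
  have h := (hf.1 _ hi).trans (hppos _ hi)
  simpa [dot, Pi.single_apply] using h

lemma bddBelow_dual_image {d : ℕ} {f : (Fin d → ℝ) → ℝ} (hf : ∀ x ∈ pos d, 0 ≤ f x)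
    {p : Fin d → ℝ} (hp : p ∈ pos d) :
    BddBelow ((fun x => dot p x / f x) '' {x | x ∈ pos d ∧ f x ≠ 0}) := by
  refine ⟨0, ?_⟩
  rintro _ ⟨x, hx, rfl⟩
  exact div_nonneg (dot_nonneg hp hx.1) (hf x hx.1)

lemma dualAntinorm_nonneg {d : ℕ} {f : (Fin d → ℝ) → ℝ} (hf : ∀ x ∈ pos d, 0 ≤ f x)
    {p : Fin d → ℝ} (hp : p ∈ pos d) : 0 ≤ dualAntinorm f p := by
  apply Real.sInf_nonneg
  rintro _ ⟨x, hx, rfl⟩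
  exact div_nonneg (dot_nonneg hp hx.1) (hf x hx.1)

lemma dualAntinorm_le {d : ℕ} {f : (Fin d → ℝ) → ℝ} (hf : ∀ x ∈ pos d, 0 ≤ f x)
    {p x : Fin d → ℝ} (hp : p ∈ pos d) (hx : x ∈ pos d) (hfx : f x ≠ 0) :
    dualAntinorm f p ≤ dot p x / f x :=
  csInf_le (bddBelow_dual_image hf hp) ⟨x, ⟨hx, hfx⟩, rfl⟩

lemma IsAntinorm.one_le_dualAntinorm {d : ℕ} {f : (Fin d → ℝ) → ℝ} (hf : IsAntinorm f)
    {p : Fin d → ℝ} (hp : ∀ y ∈ pos d, f y ≤ dot p y) : 1 ≤ dualAntinorm f p := by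
  obtain ⟨y, hy, hfy⟩ := hf.2.2.2
  refine le_csInf ⟨_, y, ⟨hy, hfy.ne'⟩, rfl⟩ ?_
  rintro _ ⟨x, hx, rfl⟩
  exact (one_le_div ((hf.1 x hx.1).lt_of_ne' hx.2)).2 (hp x hx.1)

lemma IsAntinorm.dual_dual_le_of_mem_interior {d : ℕ} {f : (Fin d → ℝ) → ℝ}
    (hf : IsAntinorm f) {x : Fin d → ℝ} (hx : x ∈ interior (pos d)) :
    dualAntinorm (dualAntinorm f) x ≤ f x := by
  obtain ⟨p, hp, hple, hpx⟩ := hf.exists_supporting hx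
  have h1 := hf.one_le_dualAntinorm hple
  refine (dualAntinorm_le (fun q => dualAntinorm_nonneg hf.1) (interior_subset hx) hp
    (by linarith)).trans ?_
  rw [dot_comm, hpx]
  exact div_le_self (hf.1 x (interior_subset hx)) h1

lemma IsAntinorm.exists_dualAntinorm_ne_zero {d : ℕ} {f : (Fin d → ℝ) → ℝ}
    (hf : IsAntinorm f) : ∃ p, p ∈ pos d ∧ dualAntinorm f p ≠ 0 := by
  have h1 : (1 : Fin d → ℝ) ∈ interior (pos d) := by
    rw [interior_pos]
    exact fun _ => one_pos
  obtain ⟨p, hp, hple, -⟩ := hf.exists_supporting h1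
  exact ⟨p, hp, by linarith [hf.one_le_dualAntinorm hple]⟩

lemma IsAntinorm.dual_dual_le_add {d : ℕ} {f : (Fin d → ℝ) → ℝ} (hf : IsAntinorm f)
    {x y : Fin d → ℝ} (hx : x ∈ pos d) (hy : y ∈ pos d) :
    dualAntinorm (dualAntinorm f) x ≤ dualAntinorm (dualAntinorm f) (x + y) := by
  obtain ⟨p₀, hp₀⟩ := hf.exists_dualAntinorm_ne_zero
  have hnonneg : ∀ p ∈ pos d, 0 ≤ dualAntinorm f p := fun p => dualAntinorm_nonneg hf.1
  refine le_csInf ⟨_, p₀, hp₀, rfl⟩ ?_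
  rintro _ ⟨p, hp, rfl⟩
  refine (dualAntinorm_le hnonneg hx hp.1 hp.2).trans ?_
  refine div_le_div_of_nonneg_right ?_ (hnonneg p hp.1)
  rw [dot_comm, dot_comm (x + y), dot_add]
  linarith [dot_nonneg hp.1 hy]

/-- The double dual of an arbitrary antinorm equals its continuous extension:
`f** = F` on `ℝ^d₊`. -/
theorem double_dual_eq_continuous_extension (d : ℕ) (f F : (Fin d → ℝ) → ℝ)
    (hf : IsAntinorm f)
    (hFcont : ContinuousOn F (pos d))
    (hFconc : ConcaveOn ℝ (pos d) F)
    (hFext : ∀ x ∈ interior (pos d), F x = f x) :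
    ∀ x ∈ pos d, dualAntinorm (dualAntinorm f) x = F x := by
  intro x hx
  have hone : (1 : Fin d → ℝ) ∈ interior (pos d) := by
    rw [interior_pos]
    exact fun _ => one_pos
  have hmem : ∀ ε : ℝ, 0 < ε → x + ε • (1 : Fin d → ℝ) ∈ interior (pos d) := fun ε hε =>
    add_mem_interior_pos hx (smul_mem_interior_pos hone hε)
  have hline : Filter.Tendsto (fun ε : ℝ => x + ε • (1 : Fin d → ℝ))
      (nhdsWithin 0 (Set.Ioi 0)) (nhds x) := by
    have : Continuous fun ε : ℝ => x + ε • (1 : Fin d → ℝ) := by fun_prop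
    simpa using (this.tendsto 0).mono_left nhdsWithin_le_nhds
  have hlim : Filter.Tendsto (fun ε : ℝ => F (x + ε • (1 : Fin d → ℝ)))
      (nhdsWithin 0 (Set.Ioi 0)) (nhds (F x)) := by
    refine (hFcont x hx).tendsto.comp (tendsto_nhdsWithin_iff.2 ⟨hline, ?_⟩)
    filter_upwards [self_mem_nhdsWithin] with ε hε
    exact interior_subset (hmem ε hε)
  apply le_antisymm
  · refine ge_of_tendsto hlim ?_
    filter_upwards [self_mem_nhdsWithin] with ε hε
    rw [hFext _ (hmem ε hε)]
    exact (hf.dual_dual_le_add hx (interior_subset (smul_mem_interior_pos hone hε))).trans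
      (hf.dual_dual_le_of_mem_interior (hmem ε hε))
  · obtain ⟨p₀, hp₀⟩ := hf.exists_dualAntinorm_ne_zero
    refine le_csInf ⟨_, p₀, hp₀, rfl⟩ ?_
    rintro _ ⟨p, hp, rfl⟩
    have hpos : 0 < dualAntinorm f p := (dualAntinorm_nonneg hf.1 hp.1).lt_of_ne' hp.2
    have hdot : Filter.Tendsto (fun ε : ℝ => dot (x + ε • (1 : Fin d → ℝ)) p / dualAntinorm f p)
        (nhdsWithin 0 (Set.Ioi 0)) (nhds (dot x p / dualAntinorm f p)) := by
      have : Continuous fun y : Fin d → ℝ => dot y p / dualAntinorm f p := by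
        unfold dot
        fun_prop
      exact (this.tendsto x).comp hline
    refine le_of_tendsto_of_tendsto hlim hdot ?_
    filter_upwards [self_mem_nhdsWithin] with ε hε
    have hfpos := hf.pos_of_mem_interior (hmem ε hε)
    rw [hFext _ (hmem ε hε), le_div_iff₀ hpos, dot_comm, mul_comm, ← le_div_iff₀ hfpos]
    exact dualAntinorm_le hf.1 hp.1 (interior_subset (hmem ε hε)) hfpos.ne'
end
end

section
/- The duality map f ↦ f* on continuous antinorms is discontinuous. Concretely, for ε ∈ [0,1] define the antinorm f_ε(x,y) = min{x,y} + ε√(xy) on ℝ²₊. Then: (a) f_0*(p,q) = p + q for all (p,q) ∈ ℝ²₊; (b) for every ε ∈ (0,1], f_ε*(1,0) = 0; and (c) sup{|f_ε(x,y) − f_0(x,y)| : x,y ≥ 0, x+y = 1} ≤ ε. Hence f_ε converges uniformly on the unit simplex to f_0 as ε → 0⁺, while f_ε*(1,0) does not converge to f_0*(1,0) = 1. -/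
open scoped BigOperators

noncomputable section

/-- The family of antinorms `f_ε(x,y) = min{x,y} + ε√(xy)` on `ℝ²₊`. -/
def feps (ε : ℝ) (x : Fin 2 → ℝ) : ℝ := min (x 0) (x 1) + ε * Real.sqrt (x 0 * x 1)

lemma feps_nonneg {ε : ℝ} (hε : 0 ≤ ε) {x : Fin 2 → ℝ} (hx : x ∈ pos 2) : 0 ≤ feps ε x :=
  add_nonneg (le_min (hx 0) (hx 1)) (mul_nonneg hε (Real.sqrt_nonneg _))

lemma dualAntinorm_feps_zero {p : Fin 2 → ℝ} (hp : p ∈ pos 2) :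
    dualAntinorm (feps 0) p = p 0 + p 1 := by
  refine IsLeast.csInf_eq ⟨⟨fun _ => 1, ⟨fun _ => zero_le_one, by simp [feps]⟩, ?_⟩, ?_⟩
  · simp [feps, dot, Fin.sum_univ_two]
  · rintro _ ⟨x, ⟨hx, hx0⟩, rfl⟩
    have hpos : 0 < feps 0 x := (feps_nonneg le_rfl hx).lt_of_ne' hx0
    have h0 : feps 0 x ≤ x 0 := by simp [feps]
    have h1 : feps 0 x ≤ x 1 := by simp [feps]
    simp only [le_div_iff₀ hpos, dot, Fin.sum_univ_two, add_mul]
    exact add_le_add (mul_le_mul_of_nonneg_left h0 (hp 0)) (mul_le_mul_of_nonneg_left h1 (hp 1))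

lemma feps_sq_one (ε : ℝ) {t : ℝ} (ht : 0 ≤ t) (ht1 : t ≤ 1) :
    feps ε ![t ^ 2, 1] = t * (t + ε) := by
  have h : t ^ 2 ≤ 1 := pow_le_one₀ ht ht1
  simp only [feps, Matrix.cons_val_zero, Matrix.cons_val_one, mul_one, min_eq_left h,
    Real.sqrt_sq ht]
  ring

lemma dualAntinorm_feps_eq_zero {ε : ℝ} (hε : 0 < ε) {p : Fin 2 → ℝ} (hp0 : p 0 = 1)
    (hp1 : p 1 = 0) : dualAntinorm (feps ε) p = 0 := by
  have hlower : ∀ r ∈ (fun x => dot p x / feps ε x) '' {x | x ∈ pos 2 ∧ feps ε x ≠ 0},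
      0 ≤ r := by
    rintro _ ⟨x, ⟨hx, -⟩, rfl⟩
    refine div_nonneg ?_ (feps_nonneg hε.le hx)
    simpa [dot, Fin.sum_univ_two, hp0, hp1] using hx 0
  refine le_antisymm (le_of_forall_pos_le_add fun δ hδ => ?_) (Real.sInf_nonneg hlower)
  obtain ⟨t, ht, ht1, htδ⟩ : ∃ t : ℝ, 0 < t ∧ t ≤ 1 ∧ t ≤ δ * ε :=
    ⟨min 1 (δ * ε), lt_min one_pos (mul_pos hδ hε), min_le_left _ _, min_le_right _ _⟩
  have hf := feps_sq_one ε ht.le ht1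
  have hmem : (![t ^ 2, 1] : Fin 2 → ℝ) ∈ pos 2 := by
    intro i
    fin_cases i
    · exact sq_nonneg t
    · exact zero_le_one
  have hpos : 0 < t * (t + ε) := by positivity
  refine (csInf_le ⟨0, hlower⟩ ⟨![t ^ 2, 1], ⟨hmem, hf ▸ hpos.ne'⟩, rfl⟩).trans ?_
  simp only [hf, dot, Fin.sum_univ_two, hp0, hp1, Matrix.cons_val_zero, Matrix.cons_val_one]
  rw [div_le_iff₀ hpos]
  nlinarith [mul_le_mul_of_nonneg_left htδ ht.le, mul_pos hδ (mul_pos ht ht)]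

lemma abs_feps_sub_feps_zero_le {ε : ℝ} (hε : 0 ≤ ε) {x : Fin 2 → ℝ} (hx : x 0 + x 1 = 1) :
    |feps ε x - feps 0 x| ≤ ε := by
  have hsqrt : Real.sqrt (x 0 * x 1) ≤ 1 := by
    rw [Real.sqrt_le_one]
    nlinarith [sq_nonneg (x 0 - x 1), sq_nonneg (x 0 + x 1)]
  have h : feps ε x - feps 0 x = ε * Real.sqrt (x 0 * x 1) := by simp [feps]
  rw [h, abs_of_nonneg (mul_nonneg hε (Real.sqrt_nonneg _))]
  exact mul_le_of_le_one_right hε hsqrt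

/-- The duality map `f ↦ f*` is discontinuous: `f_ε → f_0` uniformly on the unit
simplex as `ε → 0⁺`, yet `f_ε*(1,0) = 0` for all `ε ∈ (0,1]` while `f_0*(1,0) = 1`
(indeed `f_0*(p,q) = p + q`). -/
theorem duality_map_discontinuous :
    (∀ p ∈ pos 2, dualAntinorm (feps 0) p = p 0 + p 1) ∧
    (∀ ε : ℝ, 0 < ε → ε ≤ 1 → ∀ p : Fin 2 → ℝ, p 0 = 1 → p 1 = 0 →
      dualAntinorm (feps ε) p = 0) ∧
    (∀ ε : ℝ, 0 ≤ ε → ε ≤ 1 → ∀ x ∈ pos 2, x 0 + x 1 = 1 →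
      |feps ε x - feps 0 x| ≤ ε) := by
  exact ⟨fun p hp => dualAntinorm_feps_zero hp,
    fun ε hε _ p hp0 hp1 => dualAntinorm_feps_eq_zero hε hp0 hp1,
    fun ε hε _ x _ hx => abs_feps_sub_feps_zero_le hε hx⟩
end
end

section
/- For every ε ∈ (0,1] and every (p,q) ∈ ℝ²₊ with q ≤ (ε²/8)·p, the dual of the antinorm f_ε(x,y) = min{x,y} + ε√(xy) on ℝ²₊ satisfies f_ε*(p,q) = 2pq/(q + √(q² + ε²pq)); in particular f_ε*(p,q) ≤ (2/ε)√(pq) for such (p,q). -/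
open scoped BigOperators

noncomputable section

lemma mem_pos_two {x : Fin 2 → ℝ} : x ∈ pos 2 ↔ 0 ≤ x 0 ∧ 0 ≤ x 1 := by
  simp [pos, Fin.forall_fin_two]

/-- The value of `f_ε` at `(1, t²)` for `t ≥ 1`. -/
lemma feps_one_sq (ε : ℝ) {t : ℝ} (ht : 1 ≤ t) : feps ε ![1, t ^ 2] = 1 + ε * t := by
  have h : (1 : ℝ) ≤ t ^ 2 := one_le_pow₀ ht
  have h' : Real.sqrt (t ^ 2) = t := Real.sqrt_sq (by linarith)
  simp [feps, h, h']

lemma dualAntinorm_feps_bddBelow {ε : ℝ} (hε : 0 ≤ ε) {p : Fin 2 → ℝ} (hp : p ∈ pos 2) :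
    BddBelow ((fun x => dot p x / feps ε x) '' {x | x ∈ pos 2 ∧ feps ε x ≠ 0}) := by
  refine ⟨0, ?_⟩
  rintro _ ⟨x, ⟨hx, -⟩, rfl⟩
  exact div_nonneg (Finset.sum_nonneg fun i _ => mul_nonneg (hp i) (hx i)) (feps_nonneg hε hx)

/-- Testing the infimum at `(1, t²)`. -/
lemma dualAntinorm_feps_le {ε : ℝ} (hε : 0 ≤ ε) {p : Fin 2 → ℝ} (hp : p ∈ pos 2)
    {t : ℝ} (ht : 1 ≤ t) :
    dualAntinorm (feps ε) p ≤ (p 0 + p 1 * t ^ 2) / (1 + ε * t) := by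
  refine csInf_le (dualAntinorm_feps_bddBelow hε hp) ⟨![1, t ^ 2], ⟨?_, ?_⟩, ?_⟩
  · rw [mem_pos_two]
    exact ⟨by simp, by simpa using sq_nonneg t⟩
  · rw [feps_one_sq ε ht]
    positivity
  · simp only [feps_one_sq ε ht]
    simp [dot, Fin.sum_univ_two]

/-- A constant dominated by all quotients is a lower bound for the dual. -/
lemma le_dualAntinorm_feps {ε m : ℝ} (hε : 0 ≤ ε) (hm : 0 ≤ m) {p : Fin 2 → ℝ}
    (h : ∀ s t : ℝ, 0 ≤ s → 0 ≤ t → m * (s ^ 2 + ε * (s * t)) ≤ p 0 * s ^ 2 + p 1 * t ^ 2) :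
    m ≤ dualAntinorm (feps ε) p := by
  refine le_csInf ⟨_, ![1, 1 ^ 2], ⟨?_, ?_⟩, rfl⟩ ?_
  · simp [mem_pos_two]
  · rw [feps_one_sq ε le_rfl]
    positivity
  · rintro _ ⟨x, ⟨hx, hfx⟩, rfl⟩
    have hf : 0 < feps ε x := lt_of_le_of_ne (feps_nonneg hε hx) hfx.symm
    obtain ⟨h0, h1⟩ := mem_pos_two.1 hx
    have key := h (Real.sqrt (x 0)) (Real.sqrt (x 1)) (Real.sqrt_nonneg _) (Real.sqrt_nonneg _)
    rw [Real.sq_sqrt h0, Real.sq_sqrt h1, ← Real.sqrt_mul h0] at key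
    rw [le_div_iff₀ hf, dot, Fin.sum_univ_two]
    refine le_trans (mul_le_mul_of_nonneg_left ?_ hm) key
    exact add_le_add_left (min_le_left _ _) _

/-- The dual of `f_ε` vanishes on the first coordinate axis. -/
lemma dualAntinorm_feps_of_snd_eq_zero {ε : ℝ} (hε : 0 < ε) {p : Fin 2 → ℝ} (hp : p ∈ pos 2)
    (h1 : p 1 = 0) : dualAntinorm (feps ε) p = 0 := by
  have h0 : 0 ≤ p 0 := hp 0
  apply le_antisymm
  · refine le_of_forall_pos_le_add fun δ hδ => ?_
    have ht : 1 ≤ 1 + p 0 / (ε * δ) := le_add_of_nonneg_right (by positivity)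
    refine (dualAntinorm_feps_le hε.le hp ht).trans ?_
    rw [h1, div_le_iff₀ (by positivity)]
    have : ε * (p 0 / (ε * δ)) * δ = p 0 := by field_simp
    nlinarith [mul_pos hε hδ]
  · refine le_dualAntinorm_feps hε.le le_rfl fun s t _ _ => ?_
    rw [h1]
    nlinarith [mul_nonneg h0 (sq_nonneg s)]

/-- The dual of `f_ε` is determined by the tangency equation `ε²m² = 4q(p - m)`. -/
lemma dualAntinorm_feps_eq {ε m : ℝ} (hε : 0 < ε) {p : Fin 2 → ℝ} (hp : p ∈ pos 2)
    (h1 : 0 < p 1) (hm : 2 * p 1 ≤ m * ε) (heq : (m * ε) ^ 2 = 4 * p 1 * (p 0 - m)) :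
    dualAntinorm (feps ε) p = m := by
  have hm0 : 0 ≤ m := by
    by_contra! h
    nlinarith
  apply le_antisymm
  · have ht : 1 ≤ m * ε / (2 * p 1) := by rwa [one_le_div (by positivity)]
    refine (dualAntinorm_feps_le hε.le hp ht).trans ?_
    rw [div_le_iff₀ (by positivity)]
    refine le_of_eq ?_
    field_simp
    linear_combination (-1) * heq
  · refine le_dualAntinorm_feps hε.le hm0 fun s t _ _ => ?_
    have : 0 ≤ 4 * p 1 * (p 0 * s ^ 2 + p 1 * t ^ 2 - m * (s ^ 2 + ε * (s * t))) := by
      have h := sq_nonneg (2 * p 1 * t - m * ε * s)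
      linear_combination h + s ^ 2 * heq
    have := nonneg_of_mul_nonneg_right this (by positivity)
    linarith

/-- For `ε ∈ (0,1]` and `(p,q) ∈ ℝ²₊` with `q ≤ (ε²/8)p`, the dual antinorm of
`f_ε` satisfies `f_ε*(p,q) = 2pq/(q + √(q² + ε²pq))`; in particular
`f_ε*(p,q) ≤ (2/ε)√(pq)`. -/
theorem dual_feps_formula (ε : ℝ) (hε : 0 < ε) (hε1 : ε ≤ 1)
    (p : Fin 2 → ℝ) (hp : p ∈ pos 2) (hq : p 1 ≤ ε ^ 2 / 8 * p 0) :
    dualAntinorm (feps ε) p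
        = 2 * p 0 * p 1 / (p 1 + Real.sqrt ((p 1) ^ 2 + ε ^ 2 * p 0 * p 1)) ∧
    dualAntinorm (feps ε) p ≤ (2 / ε) * Real.sqrt (p 0 * p 1) := by
  have h0 : 0 ≤ p 0 := hp 0
  rcases (show 0 ≤ p 1 from hp 1).eq_or_lt with h1 | h1
  · rw [dualAntinorm_feps_of_snd_eq_zero hε hp h1.symm]
    simp [← h1]
  set R := Real.sqrt ((p 1) ^ 2 + ε ^ 2 * p 0 * p 1) with hR
  have hR0 : 0 ≤ R := Real.sqrt_nonneg _
  have hR2 : R ^ 2 = (p 1) ^ 2 + ε ^ 2 * p 0 * p 1 := Real.sq_sqrt (by positivity)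
  have hRq : p 1 * (1 + ε) ≤ R := by
    refine Real.le_sqrt_of_sq_le ?_
    have : p 1 * (2 * ε + ε ^ 2) ≤ ε ^ 2 * p 0 := by
      have : p 1 * (2 * ε + ε ^ 2) ≤ p 1 * 3 :=
        mul_le_mul_of_nonneg_left (by nlinarith) h1.le
      nlinarith [mul_nonneg (sq_nonneg ε) h0]
    nlinarith
  set m := 2 * p 0 * p 1 / (p 1 + R) with hm
  have hmR : m * ε ^ 2 = 2 * (R - p 1) := by
    rw [hm]
    field_simp
    linear_combination (-1) * hR2
  have heq : (m * ε) ^ 2 = 4 * p 1 * (p 0 - m) := by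
    have : ε ^ 2 * (m * ε) ^ 2 = ε ^ 2 * (4 * p 1 * (p 0 - m)) := by
      linear_combination (m * ε ^ 2 + 2 * (R - p 1) + 4 * p 1) * hmR + 4 * hR2
    exact mul_left_cancel₀ (by positivity) this
  have hm2 : 2 * p 1 ≤ m * ε := by
    refine le_of_mul_le_mul_right ?_ hε
    linear_combination 2 * hRq - hmR
  rw [dualAntinorm_feps_eq hε hp h1 hm2 heq]
  refine ⟨rfl, ?_⟩
  have hm0 : 0 ≤ m := by positivity
  have : m * ε / 2 ≤ Real.sqrt (p 0 * p 1) := by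
    refine Real.le_sqrt_of_sq_le ?_
    nlinarith [mul_nonneg h1.le hm0]
  rw [div_mul_eq_mul_div, le_div_iff₀ hε]
  linarith
end
end

section
/- The unique self-dual norm on ℝ^d is the Euclidean norm: if g is a norm on ℝ^d whose dual norm g*(p) = max{⟨p,x⟩/g(x) : x ∈ ℝ^d, x ≠ 0} satisfies g*(p) = g(p) for all p ∈ ℝ^d, then g(x) = |x| (the Euclidean norm) for all x ∈ ℝ^d. -/
open scoped BigOperators

noncomputable section

/-- The dual norm `g*(p) = sup {⟨p,x⟩/g(x) : x ≠ 0}`. -/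
def dualNorm {d : ℕ} (g : EuclideanSpace ℝ (Fin d) → ℝ)
    (p : EuclideanSpace ℝ (Fin d)) : ℝ :=
  sSup ((fun x => (∑ i, p i * x i) / g x) '' {x | x ≠ 0})

/-- The unique self-dual norm on `ℝ^d` is the Euclidean norm: if a norm `g`
satisfies `g* = g`, then `g` is the Euclidean norm. -/
theorem self_dual_norm_is_euclidean (d : ℕ)
    (g : EuclideanSpace ℝ (Fin d) → ℝ)
    (hg_pos : ∀ x, x ≠ 0 → 0 < g x)
    (hg_zero : g 0 = 0)
    (hg_hom : ∀ (a : ℝ) (x : EuclideanSpace ℝ (Fin d)), g (a • x) = |a| * g x)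
    (hg_tri : ∀ x y : EuclideanSpace ℝ (Fin d), g (x + y) ≤ g x + g y)
    (hsd : ∀ p, dualNorm g p = g p) :
    ∀ x, g x = ‖x‖ := by
  have inner_eq (p x : EuclideanSpace ℝ (Fin d)) : ∑ i, p i * x i = inner ℝ p x := by
    simp [PiLp.inner_apply, mul_comm]
  have norm_le (x : EuclideanSpace ℝ (Fin d)) (hx : x ≠ 0) : ‖x‖ ≤ g x := by
    have hgx := hg_pos x hx
    have hbdd : BddAbove ((fun y => (∑ i, x i * y i) / g y) '' {y | y ≠ 0}) := by
      by_contra h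
      have hzero : dualNorm g x = 0 := Real.sSup_of_not_bddAbove h
      rw [hsd] at hzero
      exact hgx.ne' hzero
    have hle : (∑ i, x i * x i) / g x ≤ dualNorm g x := le_csSup hbdd ⟨x, hx, rfl⟩
    rw [hsd, inner_eq, real_inner_self_eq_norm_sq, div_le_iff₀ hgx] at hle
    exact abs_le_of_sq_le_sq' (by nlinarith) hgx.le |>.2
  intro x
  by_cases hx : x = 0
  · simp [hx, hg_zero]
  refine le_antisymm ?_ (norm_le x hx)
  rw [← hsd x]
  refine csSup_le ⟨_, x, hx, rfl⟩ ?_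
  rintro _ ⟨y, hy, rfl⟩
  change (∑ i, x i * y i) / g y ≤ ‖x‖
  rw [div_le_iff₀ (hg_pos y hy), inner_eq]
  exact (real_inner_le_norm x y).trans
    (mul_le_mul_of_nonneg_left (norm_le y hy) (norm_nonneg x))
end
end

section
/- Let Ω ⊂ ℝ₊ be a union of pairwise disjoint nonempty half-open intervals (a_i, b_i], i ∈ I, where I is finite or countably infinite and 0 ≤ a_i < b_i for each i. For u ∈ ℝ₊ define ũ = u if u ∉ Ω, and ũ = a_i if u ∈ (a_i, b_i]. If φ : ℝ₊ → ℝ₊ is a monotone (nondecreasing) function with φ(0) = 0, constant on each interval (a_i, b_i], and satisfying φ(φ(u)) = ũ for all u ≥ 0, then φ(u) = ũ for all u ≥ 0. -/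
/-- Let `Ω ⊆ ℝ₊` be a union of pairwise disjoint nonempty half-open intervals
`(aᵢ, bᵢ]` over a countable (finite or countably infinite) index set, and let
`t` be the map sending `u ∉ Ω` to `u` and `u ∈ (aᵢ, bᵢ]` to `aᵢ`. If
`φ : ℝ₊ → ℝ₊` is nondecreasing, `φ(0) = 0`, `φ` is constant on each interval
`(aᵢ, bᵢ]`, and `φ(φ(u)) = t(u)` for all `u ≥ 0`, then `φ(u) = t(u)` for all
`u ≥ 0`. -/
theorem monotone_generalized_involution (I : Type*) [Countable I]
    (a b : I → ℝ) (ha : ∀ i, 0 ≤ a i) (hab : ∀ i, a i < b i)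
    (hdisj : Pairwise fun i j => Disjoint (Set.Ioc (a i) (b i)) (Set.Ioc (a j) (b j)))
    (t : ℝ → ℝ)
    (ht_out : ∀ u, 0 ≤ u → (∀ i, u ∉ Set.Ioc (a i) (b i)) → t u = u)
    (ht_in : ∀ i, ∀ u ∈ Set.Ioc (a i) (b i), t u = a i)
    (φ : ℝ → ℝ)
    (hφ_nn : ∀ u, 0 ≤ u → 0 ≤ φ u)
    (hφ_mono : ∀ u v, 0 ≤ u → u ≤ v → φ u ≤ φ v)
    (hφ0 : φ 0 = 0)
    (hφ_const : ∀ i, ∀ u ∈ Set.Ioc (a i) (b i), ∀ v ∈ Set.Ioc (a i) (b i), φ u = φ v)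
    (hφφ : ∀ u, 0 ≤ u → φ (φ u) = t u) :
    ∀ u, 0 ≤ u → φ u = t u := by
  intro u hu
  have hu' := hφ_nn u hu
  by_cases h : ∃ i, u ∈ Set.Ioc (a i) (b i)
  · obtain ⟨i, hi⟩ := h
    have hφφu : φ (φ u) = a i := (hφφ u hu).trans (ht_in i u hi)
    rw [ht_in i u hi]
    have hle : φ u ≤ a i := by
      by_contra! hlt
      rcases le_or_gt (φ u) (b i) with hb | hb
      · have := hφ_const i (φ u) ⟨hlt, hb⟩ u hi
        linarith
      · have := hφ_mono u (φ u) hu (hi.2.trans hb.le)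
        linarith
    have h₁ := hφ_mono (φ u) (a i) hu' hle
    have h₂ := hφ_mono (a i) u (ha i) hi.1.le
    linarith
  · have htu : t u = u := ht_out u hu (not_exists.mp h)
    have hφφu := hφφ u hu
    rw [htu] at hφφu ⊢
    rcases le_total (φ u) u with hle | hle
    · have := hφ_mono (φ u) u hu' hle
      linarith
    · have := hφ_mono u (φ u) hu hle
      linarith
end

section
/- The unique symmetric self-dual antinorm on ℝ²₊ is f(x,y) = √(2xy): if f is a continuous antinorm on ℝ²₊ satisfying f(x,y) = f(y,x) for all (x,y) ∈ ℝ²₊ and f* = f, then f(x,y) = √(2xy) for all (x,y) ∈ ℝ²₊. -/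
open scoped BigOperators

noncomputable section

/-- The defining inequality of the dual antinorm. -/
theorem dualAntinorm_mul_le {d : ℕ} {f : (Fin d → ℝ) → ℝ} (hf : ∀ x ∈ pos d, 0 ≤ f x)
    {p x : Fin d → ℝ} (hp : p ∈ pos d) (hx : x ∈ pos d) :
    dualAntinorm f p * f x ≤ dot p x := by
  have dot_nonneg : ∀ y ∈ pos d, 0 ≤ dot p y := fun y hy =>
    Finset.sum_nonneg fun i _ => mul_nonneg (hp i) (hy i)
  rcases (hf x hx).eq_or_lt with h | h
  · rw [← h, mul_zero]
    exact dot_nonneg x hx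
  · rw [← le_div_iff₀ h]
    refine csInf_le ⟨0, ?_⟩ ⟨x, ⟨hx, h.ne'⟩, rfl⟩
    rintro _ ⟨y, ⟨hy, -⟩, rfl⟩
    exact div_nonneg (dot_nonneg y hy) (hf y hy)

/-- A lower bound on the dual antinorm. -/
theorem le_dualAntinorm {d : ℕ} {f : (Fin d → ℝ) → ℝ} (hf : IsAntinorm f)
    {p : Fin d → ℝ} {c : ℝ} (h : ∀ x ∈ pos d, c * f x ≤ dot p x) :
    c ≤ dualAntinorm f p := by
  obtain ⟨z, hz, hfz⟩ := hf.2.2.2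
  refine le_csInf ⟨_, z, ⟨hz, hfz.ne'⟩, rfl⟩ ?_
  rintro _ ⟨y, ⟨hy, hfy⟩, rfl⟩
  exact (le_div_iff₀ ((hf.1 y hy).lt_of_ne' hfy)).2 (h y hy)

/-- Self-duality of `√(2xy)` in the form of an inequality. -/
theorem sqrt_mul_sqrt_le_dot {p x : Fin 2 → ℝ} (hp : p ∈ pos 2) (hx : x ∈ pos 2) :
    Real.sqrt (2 * p 0 * p 1) * Real.sqrt (2 * x 0 * x 1) ≤ dot p x := by
  have h0 := mul_nonneg (hp 0) (hx 0)
  have h1 := mul_nonneg (hp 1) (hx 1)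
  rw [← Real.sqrt_mul (mul_nonneg (mul_nonneg zero_le_two (hp 0)) (hp 1)), dot, Fin.sum_univ_two]
  refine Real.sqrt_le_iff.2 ⟨add_nonneg h0 h1, ?_⟩
  nlinarith [sq_nonneg (p 0 * x 0 - p 1 * x 1)]

/-- The unique symmetric self-dual antinorm on `ℝ²₊` is `f(x,y) = √(2xy)`. -/
theorem unique_symmetric_self_dual_antinorm
    (f : (Fin 2 → ℝ) → ℝ)
    (hf : IsAntinorm f) (hc : ContinuousOn f (pos 2))
    (hsym : ∀ p ∈ pos 2, ∀ q : Fin 2 → ℝ, q 0 = p 1 → q 1 = p 0 → f q = f p)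
    (hsd : ∀ p ∈ pos 2, dualAntinorm f p = f p) :
    ∀ x ∈ pos 2, f x = Real.sqrt (2 * x 0 * x 1) := by
  have upper : ∀ x ∈ pos 2, f x ≤ Real.sqrt (2 * x 0 * x 1) := by
    intro x hx
    have hq : (![x 1, x 0] : Fin 2 → ℝ) ∈ pos 2 := Fin.forall_fin_two.2 ⟨hx 1, hx 0⟩
    have h := dualAntinorm_mul_le hf.1 hx hq
    rw [hsd x hx, hsym x hx ![x 1, x 0] rfl rfl] at h
    simp only [dot, Fin.sum_univ_two, Matrix.cons_val_zero, Matrix.cons_val_one] at h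
    exact Real.le_sqrt_of_sq_le (by linarith)
  intro x hx
  refine le_antisymm (upper x hx) ?_
  rw [← hsd x hx]
  exact le_dualAntinorm hf fun y hy =>
    (mul_le_mul_of_nonneg_left (upper y hy) (Real.sqrt_nonneg _)).trans
      (sqrt_mul_sqrt_le_dot hx hy)
end
end

section
/- Duality does not preserve Lyapunov antinorms for random matrix products: let q ∈ (√2/2, 1), let A₁ = q·[[1,1],[0,1]] and A₂ = q·[[1,0],[1,1]] (so A₂ = A₁ᵀ), and let f(x,y) = x + y on ℝ²₊, whose dual is f*(x,y) = min{x,y}. Then: (a) for every x ∈ ℝ²₊, √(f(A₁x)·f(A₂x)) ≥ q√2 · f(x), and since q√2 > 1 this strictly exceeds f(x) whenever f(x) > 0; but (b) at the point x = (1,1) one has √(f*(A₁x)·f*(A₂x)) = q < 1 = f*(x). Hence f is a Lyapunov antinorm for the pair {A₁, A₂} (with equal probabilities 1/2), while f* is not a Lyapunov antinorm for the transposed pair {A₁ᵀ, A₂ᵀ} = {A₂, A₁}. -/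
open scoped BigOperators

noncomputable section

/-- The dual of the antinorm `x + y` on the positive orthant of the plane is `min {x, y}`. -/
theorem dualAntinorm_eq_min {f : (Fin 2 → ℝ) → ℝ} (hf : ∀ x, f x = x 0 + x 1)
    (p : Fin 2 → ℝ) : dualAntinorm f p = min (p 0) (p 1) := by
  refine IsLeast.csInf_eq ⟨?_, ?_⟩
  · rcases le_total (p 0) (p 1) with h | h
    · refine ⟨![1, 0], ⟨fun i => by fin_cases i <;> simp, by simp [hf]⟩, ?_⟩
      simp [hf, dot, h]
    · refine ⟨![0, 1], ⟨fun i => by fin_cases i <;> simp, by simp [hf]⟩, ?_⟩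
      simp [hf, dot, h]
  · rintro _ ⟨x, ⟨hx, hfx⟩, rfl⟩
    have h0 := hx 0
    have h1 := hx 1
    rw [hf] at hfx
    have hpos : 0 < x 0 + x 1 := lt_of_le_of_ne (add_nonneg h0 h1) (Ne.symm hfx)
    simp only [hf, dot, Fin.sum_univ_two]
    rw [le_div_iff₀ hpos, mul_add]
    gcongr
    · exact min_le_left _ _
    · exact min_le_right _ _

/-- Duality does not preserve Lyapunov antinorms for random matrix products:
with `q ∈ (√2/2, 1)`, `A₁ = q[[1,1],[0,1]]`, `A₂ = q[[1,0],[1,1]]`,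
`f(x,y) = x + y` (whose dual is `g(x,y) = min{x,y}`), `f` is a Lyapunov antinorm
for `{A₁, A₂}` with probabilities `1/2`, but `g = f*` is not a Lyapunov antinorm
for the transposed pair: at `x = (1,1)` the geometric mean drops below `g(x)`. -/
theorem lyapunov_antinorm_dual_counterexample
    (q : ℝ) (hq : Real.sqrt 2 / 2 < q) (hq1 : q < 1)
    (A₁ A₂ : Matrix (Fin 2) (Fin 2) ℝ)
    (hA₁ : A₁ = q • !![1, 1; 0, 1]) (hA₂ : A₂ = q • !![1, 0; 1, 1])
    (f g : (Fin 2 → ℝ) → ℝ)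
    (hf : ∀ x, f x = x 0 + x 1) (hg : ∀ x, g x = min (x 0) (x 1)) :
    (∀ p ∈ pos 2, dualAntinorm f p = g p) ∧
    (∀ x ∈ pos 2, q * Real.sqrt 2 * f x ≤
      Real.sqrt (f (A₁.mulVec x) * f (A₂.mulVec x))) ∧
    (1 < q * Real.sqrt 2) ∧
    (∀ x ∈ pos 2, 0 < f x →
      f x < Real.sqrt (f (A₁.mulVec x) * f (A₂.mulVec x))) ∧
    (Real.sqrt (g (A₁.mulVec ![1, 1]) * g (A₂.mulVec ![1, 1])) = q) ∧
    (g ![1, 1] = 1) ∧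
    (Real.sqrt (g (A₁.mulVec ![1, 1]) * g (A₂.mulVec ![1, 1])) < g ![1, 1]) := by
  have hs : Real.sqrt 2 * Real.sqrt 2 = 2 := Real.mul_self_sqrt (by norm_num)
  have hs0 : 0 < Real.sqrt 2 := Real.sqrt_pos.2 (by norm_num)
  have hq0 : 0 < q := lt_trans (by positivity) hq
  have hlt : 1 < q * Real.sqrt 2 := by nlinarith
  have hmain : ∀ x ∈ pos 2, q * Real.sqrt 2 * f x ≤
      Real.sqrt (f (A₁.mulVec x) * f (A₂.mulVec x)) := by
    intro x hx
    have h0 := hx 0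
    have h1 := hx 1
    apply Real.le_sqrt_of_sq_le
    have hsq : (q * Real.sqrt 2 * f x) ^ 2 = 2 * q ^ 2 * (x 0 + x 1) ^ 2 := by
      rw [hf, mul_pow, mul_pow, sq (Real.sqrt 2), hs]
      ring
    have hprod : f (A₁.mulVec x) * f (A₂.mulVec x) =
        2 * q ^ 2 * (x 0 + x 1) ^ 2 + q ^ 2 * (x 0 * x 1) := by
      simp [hf, hA₁, hA₂, dotProduct, Fin.sum_univ_two]
      ring
    rw [hsq, hprod]
    exact le_add_of_nonneg_right (by positivity)
  have hone : g ![1, 1] = 1 := by simp [hg]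
  have hval : Real.sqrt (g (A₁.mulVec ![1, 1]) * g (A₂.mulVec ![1, 1])) = q := by
    have h₁ : g (A₁.mulVec ![1, 1]) = q := by
      simp [hg, hA₁, hq0.le]
    have h₂ : g (A₂.mulVec ![1, 1]) = q := by
      simp [hg, hA₂, hq0.le]
    rw [h₁, h₂, Real.sqrt_mul_self hq0.le]
  refine ⟨fun p _ => by rw [dualAntinorm_eq_min hf, hg], hmain, hlt, fun x hx hfx => ?_,
    hval, hone, by rwa [hval, hone]⟩
  exact (lt_mul_of_one_lt_left hfx hlt).trans_le (hmain x hx)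
end
end
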